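/- arXiv:1511.04007 — 2 statements merged into one kernel-verified Lean document; each statement's English description precedes it below -/
import Mathlib

section
/- If f is a real-valued function in C²[a,b] with f(a)=f(b)=f'(a)=f'(b)=0, then ∫ₐᵇ |f(x)|² dx ≤ (1/τ)((b-a)/π)⁴ ∫ₐᵇ |f''(x)|² dx, where τ is the smallest positive root of tanh(πτ^{1/4}/2) + tan(πτ^{1/4}/2) = 0. -/
open Real Set

/-- `1 - cosh s cos s` is, up to a factor, the Wronskian of the solutions `cosh - cos` and
`sinh - sin` of `u'''' = u`. It factors in terms of the half argument. -/
theorem one_sub_cosh_mul_cos_two_mul (c : ℝ) :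
    1 - cosh (2 * c) * cos (2 * c) =
      2 * (cosh c * sin c - sinh c * cos c) * (cosh c * sin c + sinh c * cos c) := by
  rw [Real.cosh_two_mul, Real.cos_two_mul, Real.cosh_sq]
  linear_combination (-2 * (sinh c ^ 2 + 1)) * Real.sin_sq_add_cos_sq c
    - 2 * sin c ^ 2 * Real.cosh_sq c

theorem cosh_mul_sin_sub_sinh_mul_cos_pos {c : ℝ} (h0 : 0 < c) (hc : c < π) :
    0 < cosh c * sin c - sinh c * cos c := by
  have hd : ∀ x : ℝ, HasDerivAt (fun x => cosh x * sin x - sinh x * cos x)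
      (2 * sinh x * sin x) x := fun x =>
    (((Real.hasDerivAt_cosh x).mul (Real.hasDerivAt_sin x)).sub
      ((Real.hasDerivAt_sinh x).mul (Real.hasDerivAt_cos x))).congr_deriv (by ring)
  have hmono : StrictMonoOn (fun x => cosh x * sin x - sinh x * cos x) (Icc 0 π) := by
    refine strictMonoOn_of_deriv_pos (convex_Icc 0 π)
      (fun x _ => (hd x).continuousAt.continuousWithinAt) fun x hx => ?_
    rw [interior_Icc] at hx
    rw [(hd x).deriv]
    exact mul_pos (mul_pos two_pos (Real.sinh_pos_iff.2 hx.1)) (sin_pos_of_pos_of_lt_pi hx.1 hx.2)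
  simpa using hmono ⟨le_rfl, pi_pos.le⟩ ⟨h0.le, hc.le⟩ h0

theorem tanh_add_tan_eq_zero_of_cosh_mul_sin_add_sinh_mul_cos {c : ℝ}
    (h : cosh c * sin c + sinh c * cos c = 0) : tanh c + tan c = 0 := by
  have hC := (Real.cosh_pos c).ne'
  have hcos : cos c ≠ 0 := fun h0 => by
    have hs : sin c = 0 := by simpa [h0, hC] using h
    simpa [h0, hs] using Real.sin_sq_add_cos_sq c
  rw [Real.tanh_eq_sinh_div_cosh, Real.tan_eq_sin_div_cos, div_add_div _ _ hC hcos]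
  simp [add_comm, h]

/-- If `tanh + tan` has no zero in `(0, r)`, then `1 - cosh cos` is positive on `(0, 2r)`. -/
theorem one_sub_cosh_mul_cos_pos {r : ℝ} (hr : ∀ c, 0 < c → tanh c + tan c = 0 → r ≤ c)
    {s : ℝ} (h0 : 0 < s) (hs : s < 2 * r) : 0 < 1 - cosh s * cos s := by
  have hcont : Continuous fun x : ℝ => cosh x * sin x + sinh x * cos x := by fun_prop
  have hpi : 0 < π / 2 := by positivity
  have hmid : 0 < cosh (π / 2) * sin (π / 2) + sinh (π / 2) * cos (π / 2) := by
    simpa using Real.cosh_pos _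
  have hroot : ∀ c, π / 2 ≤ c → cosh c * sin c + sinh c * cos c ≤ 0 → r ≤ c := by
    intro c hc hle
    obtain ⟨z, hz, hz0⟩ := intermediate_value_Icc' hc hcont.continuousOn ⟨hle, hmid.le⟩
    exact (hr z (hpi.trans_le hz.1)
      (tanh_add_tan_eq_zero_of_cosh_mul_sin_add_sinh_mul_cos hz0)).trans hz.2
  have hrpi : r ≤ π := hroot π (by linarith) (by simp [Real.sinh_nonneg_iff, pi_pos.le])
  obtain ⟨c, rfl⟩ : ∃ c, s = 2 * c := ⟨s / 2, by ring⟩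
  have hc0 : 0 < c := by linarith
  have hcr : c < r := by linarith
  rw [one_sub_cosh_mul_cos_two_mul]
  refine mul_pos (mul_pos two_pos (cosh_mul_sin_sub_sinh_mul_cos_pos hc0 (by linarith))) ?_
  rcases lt_or_ge c (π / 2) with h | h
  · exact add_pos (mul_pos (Real.cosh_pos c) (sin_pos_of_pos_of_lt_pi hc0 (by linarith)))
      (mul_pos (Real.sinh_pos_iff.2 hc0) (cos_pos_of_mem_Ioo ⟨by linarith, h⟩))
  · by_contra! hle
    exact absurd (hroot c h hle) (by linarith)

/-- The quadratic form, in `v = f(x)` and `w = f'(x)`, whose derivative along `f` completes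
`f''² - k⁴ f²` to a square; here `s = k x + ε`. -/
noncomputable def beamForm (k s v w : ℝ) : ℝ :=
  (-k * (cosh s * sin s - sinh s * cos s) * w ^ 2 + 2 * k ^ 2 * (sinh s * sin s) * (v * w)
    - k ^ 3 * (cosh s * sin s + sinh s * cos s) * v ^ 2) / (1 - cosh s * cos s)

theorem hasDerivAt_beamForm {k e a x f2 : ℝ} {f f1 : ℝ → ℝ} (hf : HasDerivAt f (f1 x) x)
    (hf1 : HasDerivAt f1 f2 x) (hD : 1 - cosh (k * (x - a) + e) * cos (k * (x - a) + e) ≠ 0) :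
    HasDerivAt (fun y => beamForm k (k * (y - a) + e) (f y) (f1 y))
      ((f2 + (-k * (cosh (k * (x - a) + e) * sin (k * (x - a) + e)
          - sinh (k * (x - a) + e) * cos (k * (x - a) + e)) * f1 x
        + k ^ 2 * (sinh (k * (x - a) + e) * sin (k * (x - a) + e)) * f x)
          / (1 - cosh (k * (x - a) + e) * cos (k * (x - a) + e))) ^ 2
        - (f2 ^ 2 - k ^ 4 * f x ^ 2)) x := by
  have hs : HasDerivAt (fun y => k * (y - a) + e) k x := by
    simpa using (((hasDerivAt_id x).sub_const a).const_mul k).add_const e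
  have hC := hs.cosh
  have hS := hs.sinh
  have hc := hs.cos
  have hn := hs.sin
  have hQ := ((((((hC.mul hn).sub (hS.mul hc)).const_mul (-k)).mul (hf1.pow 2)).add
    (((hS.mul hn).const_mul (2 * k ^ 2)).mul (hf.mul hf1))).sub
    ((((hC.mul hn).add (hS.mul hc)).const_mul (k ^ 3)).mul (hf.pow 2))).div
    ((hC.mul hc).const_sub 1) hD
  refine hQ.congr_deriv ?_
  simp only [Pi.mul_apply, Pi.sub_apply, Pi.add_apply, Pi.pow_apply]
  have hid : -2 * (cosh (k * (x - a) + e) * cos (k * (x - a) + e))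
        * (1 - cosh (k * (x - a) + e) * cos (k * (x - a) + e))
      + (cosh (k * (x - a) + e) ^ 2 * sin (k * (x - a) + e) ^ 2
        - sinh (k * (x - a) + e) ^ 2 * cos (k * (x - a) + e) ^ 2)
      = sinh (k * (x - a) + e) ^ 2 * sin (k * (x - a) + e) ^ 2
        + (1 - cosh (k * (x - a) + e) * cos (k * (x - a) + e)) ^ 2 := by
    rw [Real.cosh_sq, Real.sin_sq]
    linear_combination cos (k * (x - a) + e) ^ 2 * Real.cosh_sq (k * (x - a) + e)
  generalize k * (x - a) + e = s at *
  field_simp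
  linear_combination k ^ 4 * f x ^ 2 * hid

theorem pow_four_mul_integral_sq_le {a b k e : ℝ} (hab : a ≤ b) {f f1 f2 : ℝ → ℝ}
    (hfc : ContinuousOn f (Icc a b)) (hf1c : ContinuousOn f1 (Icc a b))
    (hf2c : ContinuousOn f2 (Icc a b)) (hf : ∀ x ∈ Ioo a b, HasDerivAt f (f1 x) x)
    (hf1 : ∀ x ∈ Ioo a b, HasDerivAt f1 (f2 x) x)
    (hfa : f a = 0) (hfb : f b = 0) (hfa' : f1 a = 0) (hfb' : f1 b = 0)
    (hD : ∀ x ∈ Icc a b, 1 - cosh (k * (x - a) + e) * cos (k * (x - a) + e) ≠ 0) :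
    k ^ 4 * ∫ x in a..b, f x ^ 2 ≤ ∫ x in a..b, f2 x ^ 2 := by
  have hint : ∀ {g : ℝ → ℝ}, ContinuousOn g (Icc a b) →
      IntervalIntegrable g MeasureTheory.volume a b := fun hg =>
    ContinuousOn.intervalIntegrable (by rwa [uIcc_of_le hab])
  set q : ℝ → ℝ := fun x => (f2 x + (-k * (cosh (k * (x - a) + e) * sin (k * (x - a) + e)
          - sinh (k * (x - a) + e) * cos (k * (x - a) + e)) * f1 x
        + k ^ 2 * (sinh (k * (x - a) + e) * sin (k * (x - a) + e)) * f x)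
          / (1 - cosh (k * (x - a) + e) * cos (k * (x - a) + e))) ^ 2
  have hqc : ContinuousOn q (Icc a b) := by
    refine (hf2c.add (ContinuousOn.div ?_ ?_ hD)).pow 2 <;> fun_prop
  have hQc : ContinuousOn (fun y => beamForm k (k * (y - a) + e) (f y) (f1 y)) (Icc a b) := by
    unfold beamForm
    refine ContinuousOn.div ?_ ?_ hD <;> fun_prop
  have hrc : ContinuousOn (fun x => f2 x ^ 2 - k ^ 4 * f x ^ 2) (Icc a b) := by fun_prop
  have key := intervalIntegral.integral_eq_sub_of_hasDerivAt_of_le hab hQc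
    (fun x hx => hasDerivAt_beamForm (hf x hx) (hf1 x hx) (hD x (Ioo_subset_Icc_self hx)))
    (hint (hqc.sub hrc))
  rw [intervalIntegral.integral_sub (hint hqc) (hint hrc),
    intervalIntegral.integral_sub (f := fun x => f2 x ^ 2) (hint (hf2c.pow 2)) (hint (by fun_prop)),
    intervalIntegral.integral_const_mul] at key
  have hpos : 0 ≤ ∫ x in a..b, q x :=
    intervalIntegral.integral_nonneg hab fun x _ => sq_nonneg _
  simp only [beamForm, hfa, hfb, hfa', hfb'] at key
  norm_num at key
  linarith

/-- Arthurs–Anderson–Hall inequality: if `f ∈ C²[a,b]` is real valued with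
`f(a) = f(b) = f'(a) = f'(b) = 0`, then
`∫ₐᵇ |f|² ≤ (1/τ)((b−a)/π)⁴ ∫ₐᵇ |f''|²`, where `τ` is the smallest positive root of
`tanh(πτ^{1/4}/2) + tan(πτ^{1/4}/2) = 0`. -/
theorem stmt_0 (a b : ℝ) (hab : a < b) (f : ℝ → ℝ)
    (hf : ContDiffOn ℝ 2 f (Icc a b))
    (hfa : f a = 0) (hfb : f b = 0)
    (hfa' : derivWithin f (Icc a b) a = 0) (hfb' : derivWithin f (Icc a b) b = 0)
    (τ : ℝ) (hτpos : 0 < τ)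
    (hτroot : Real.tanh (π * τ ^ ((1 : ℝ) / 4) / 2) + Real.tan (π * τ ^ ((1 : ℝ) / 4) / 2) = 0)
    (hτmin : ∀ t : ℝ, 0 < t →
      Real.tanh (π * t ^ ((1 : ℝ) / 4) / 2) + Real.tan (π * t ^ ((1 : ℝ) / 4) / 2) = 0 → τ ≤ t) :
    ∫ x in a..b, |f x| ^ 2
      ≤ (1 / τ) * ((b - a) / π) ^ 4 * ∫ x in a..b, |iteratedDerivWithin 2 f (Icc a b) x| ^ 2 := by
  simp only [sq_abs]
  have hu := uniqueDiffOn_Icc hab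
  have hba : 0 < b - a := sub_pos.2 hab
  have hpow : ∀ {t : ℝ}, 0 ≤ t → (t ^ 4) ^ ((1 : ℝ) / 4) = t := fun ht => by
    simpa using Real.pow_rpow_inv_natCast ht (n := 4) (by norm_num)
  obtain ⟨q, hq0, rfl⟩ : ∃ q : ℝ, 0 < q ∧ τ = q ^ 4 :=
    ⟨τ ^ ((1 : ℝ) / 4), rpow_pos_of_pos hτpos _, by
      simpa using (Real.rpow_inv_natCast_pow hτpos.le (n := 4) (by norm_num)).symm⟩
  have hmin : ∀ c, 0 < c → tanh c + tan c = 0 → π * q / 2 ≤ c := by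
    intro c hc h
    have hcp : 0 < 2 * c / π := by positivity
    have hle := hτmin ((2 * c / π) ^ 4) (by positivity) (by
      rw [hpow hcp.le]
      have : π * (2 * c / π) / 2 = c := by field_simp
      rwa [this])
    have := le_of_pow_le_pow_left₀ (by norm_num) hcp.le hle
    rw [le_div_iff₀ pi_pos] at this
    linarith
  have hf1 : ContDiffOn ℝ 1 (derivWithin f (Icc a b)) (Icc a b) := hf.derivWithin hu (by norm_num)
  have h2 : EqOn (iteratedDerivWithin 2 f (Icc a b))
      (derivWithin (derivWithin f (Icc a b)) (Icc a b)) (Icc a b) := fun x _ => by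
    rw [iteratedDerivWithin_succ]
    congr 1
    exact iteratedDerivWithin_one
  have hderiv : ∀ {g : ℝ → ℝ}, DifferentiableOn ℝ g (Icc a b) → ∀ x ∈ Ioo a b,
      HasDerivAt g (derivWithin g (Icc a b) x) x := fun hg x hx =>
    (hg x (Ioo_subset_Icc_self hx)).hasDerivWithinAt.hasDerivAt (Icc_mem_nhds hx.1 hx.2)
  have hbound : ∀ k ∈ Ioo 0 (π * q / (b - a)),
      k ^ 4 * ∫ x in a..b, f x ^ 2 ≤ ∫ x in a..b, iteratedDerivWithin 2 f (Icc a b) x ^ 2 := by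
    intro k hk
    have hk2 : k * (b - a) < π * q := (lt_div_iff₀ hba).1 hk.2
    refine pow_four_mul_integral_sq_le (e := (π * q - k * (b - a)) / 2) hab.le hf.continuousOn
      hf1.continuousOn (hf.continuousOn_iteratedDerivWithin (by norm_num) hu)
      (hderiv (hf.differentiableOn (by norm_num))) (fun x hx => ?_) hfa hfb hfa' hfb' fun x hx => ?_
    · rw [h2 (Ioo_subset_Icc_self hx)]
      exact hderiv (hf1.differentiableOn (by norm_num)) x hx
    · have h1 : 0 ≤ k * (x - a) := mul_nonneg hk.1.le (sub_nonneg.2 hx.1)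
      have h3 : k * (x - a) ≤ k * (b - a) :=
        mul_le_mul_of_nonneg_left (by linarith [hx.2]) hk.1.le
      exact (one_sub_cosh_mul_cos_pos hmin (by linarith) (by linarith)).ne'
  have hlim : (π * q / (b - a)) ^ 4 * ∫ x in a..b, f x ^ 2
      ≤ ∫ x in a..b, iteratedDerivWithin 2 f (Icc a b) x ^ 2 := by
    have hcont : Continuous fun k : ℝ => k ^ 4 * ∫ x in a..b, f x ^ 2 := by fun_prop
    exact le_of_tendsto (hcont.continuousWithinAt (s := Iio (π * q / (b - a))))
      (Filter.eventually_of_mem (Ioo_mem_nhdsLT (by positivity)) hbound)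
  have hconst : 1 / q ^ 4 * ((b - a) / π) ^ 4 = ((π * q / (b - a)) ^ 4)⁻¹ := by
    field_simp
  rw [hconst, inv_mul_eq_div, le_div_iff₀ (by positivity)]
  linarith
end

section
/- The Wirtinger-Sobolev constant c_r, defined as the minimal eigenvalue of (−1)ʳ u^{(2r)} = λu on [0,1] with u^{(k)}(0) = u^{(k)}(1) = 0 for 0 ≤ k ≤ r−1, satisfies (4r−2)/(4r²−r) · (4r)!(r!)²/((2r)!)² ≤ c_r ≤ (4r+1)/(2r+1) · (4r)!(r!)²/((2r)!)² for every r ≥ 1. -/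
open Set

/-- The Wirtinger–Sobolev constant `c_r`: the optimal (largest) constant `c` such that
`c · ∫₀¹ |f|² ≤ ∫₀¹ |f^{(r)}|²` for all `f ∈ Cʳ[0,1]` vanishing to order `r` at `0` and `1`. -/
noncomputable def wirtingerConst (r : ℕ) : ℝ :=
  sSup {c : ℝ | ∀ f : ℝ → ℂ, ContDiffOn ℝ r f (Icc 0 1) →
    (∀ l < r, iteratedDerivWithin l f (Icc 0 1) 0 = 0 ∧ iteratedDerivWithin l f (Icc 0 1) 1 = 0) →
    c * (∫ x in (0:ℝ)..1, ‖f x‖ ^ 2)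
      ≤ ∫ x in (0:ℝ)..1, ‖iteratedDerivWithin r f (Icc 0 1) x‖ ^ 2}

open Polynomial in
/-- Iterated integration by parts against a polynomial, with vanishing boundary terms. -/
lemma integral_mul_eval_iterate_derivative (r : ℕ) (F : ℕ → ℝ → ℝ) (Q : ℝ[X])
    (hF : ∀ k ≤ r, ContinuousOn (F k) (Icc 0 1))
    (hF' : ∀ k < r, ∀ x ∈ Ioo (0 : ℝ) 1, HasDerivAt (F k) (F (k + 1) x) x)
    (h0 : ∀ k < r, F k 0 = 0 ∧ F k 1 = 0) :
    ∫ x in (0 : ℝ)..1, F r x * Q.eval x =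
      (-1) ^ r * ∫ x in (0 : ℝ)..1, F 0 x * (derivative^[r] Q).eval x := by
  induction r generalizing Q with
  | zero => simp
  | succ r ih =>
    have hparts := intervalIntegral.integral_mul_deriv_eq_deriv_mul_of_hasDerivAt
      (a := 0) (b := 1) (u := F r) (u' := F (r + 1)) (v := fun x => Q.eval x)
      (v' := fun x => (derivative Q).eval x)
      (by simpa using hF r (by omega)) (by fun_prop)
      (by simpa using hF' r (by omega)) (fun x _ => Q.hasDerivAt x)
      (ContinuousOn.intervalIntegrable (by simpa using hF (r + 1) le_rfl))
      (Continuous.intervalIntegrable (by fun_prop) _ _)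
    have hr := ih (derivative Q) (fun k hk => hF k (by omega)) (fun k hk => hF' k (by omega))
      (fun k hk => h0 k (by omega))
    obtain ⟨h00, h01⟩ := h0 r (by omega)
    rw [h00, h01] at hparts
    rw [Function.iterate_succ_apply, pow_succ, mul_neg_one, neg_mul, ← hr]
    linarith

namespace Polynomial

/-- Integration of polynomials over the unit interval. -/
noncomputable def unitIntegral : ℝ[X] →ₗ[ℝ] ℝ where
  toFun p := ∫ x in (0 : ℝ)..1, p.eval x
  map_add' p q := by
    simp only [eval_add]
    exact intervalIntegral.integral_add (p.continuous.intervalIntegrable _ _)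
      (q.continuous.intervalIntegrable _ _)
  map_smul' c p := by simp

lemma unitIntegral_apply (p : ℝ[X]) : unitIntegral p = ∫ x in (0 : ℝ)..1, p.eval x := rfl

lemma unitIntegral_C_mul (c : ℝ) (p : ℝ[X]) : unitIntegral (C c * p) = c * unitIntegral p := by
  rw [← smul_eq_C_mul, map_smul, smul_eq_mul]

lemma unitIntegral_mono {p q : ℝ[X]} (h : ∀ x ∈ Icc (0 : ℝ) 1, p.eval x ≤ q.eval x) :
    unitIntegral p ≤ unitIntegral q :=
  intervalIntegral.integral_mono_on zero_le_one (p.continuous.intervalIntegrable _ _)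
    (q.continuous.intervalIntegrable _ _) h

lemma iterate_derivative_weight_eval_eq_zero {r k : ℕ} (hk : k < r) (g : ℝ[X]) :
    (derivative^[k] ((X * (1 - X)) ^ r * g)).eval 0 = 0 ∧
      (derivative^[k] ((X * (1 - X)) ^ r * g)).eval 1 = 0 := by
  have hdvd : X * (1 - X) ∣ derivative^[k] ((X * (1 - X)) ^ r * g) :=
    (dvd_pow_self _ (by omega)).trans
      (pow_sub_dvd_iterate_derivative_of_pow_dvd k (dvd_mul_right _ _))
  obtain ⟨s, hs⟩ := hdvd
  simp [hs]

lemma unitIntegral_iterate_derivative_mul (r : ℕ) (g h : ℝ[X]) :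
    unitIntegral (derivative^[r] ((X * (1 - X)) ^ r * g) * h) =
      (-1) ^ r * unitIntegral ((X * (1 - X)) ^ r * g * derivative^[r] h) := by
  have key := integral_mul_eval_iterate_derivative r
    (fun k x => (derivative^[k] ((X * (1 - X)) ^ r * g)).eval x) h
    (fun k _ => (Polynomial.continuous _).continuousOn)
    (fun k _ x _ => by
      rw [Function.iterate_succ_apply']
      exact Polynomial.hasDerivAt _ x)
    (fun k hk => iterate_derivative_weight_eval_eq_zero hk g)
  simpa [unitIntegral_apply] using key

lemma natDegree_weight_pow_le (r : ℕ) : ((X * (1 - X) : ℝ[X]) ^ r).natDegree ≤ 2 * r := by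
  have h : (X * (1 - X) : ℝ[X]).natDegree ≤ 2 := by compute_degree
  calc _ ≤ r * 2 := natDegree_pow_le_of_le r h
    _ = 2 * r := mul_comm _ _

lemma coeff_weight_pow (r : ℕ) : ((X * (1 - X) : ℝ[X]) ^ r).coeff (2 * r) = (-1) ^ r := by
  have h : (X * (1 - X) : ℝ[X]).natDegree ≤ 2 := by compute_degree
  rw [mul_comm 2 r, coeff_pow_of_natDegree_le h]
  congr 1
  rw [show (2 : ℕ) = 1 + 1 from rfl, coeff_X_mul]
  simp [coeff_one, coeff_X]

lemma unitIntegral_X_pow_mul (a b : ℕ) :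
    unitIntegral (X ^ a * (1 - X) ^ b) =
      (a.factorial * b.factorial : ℝ) / (a + b + 1).factorial := by
  induction b generalizing a with
  | zero =>
    simp [unitIntegral_apply, Nat.factorial_succ]
    field_simp
  | succ b ih =>
    have hparts : unitIntegral (derivative (X ^ (a + 1) * (1 - X) ^ (b + 1))) = 0 := by
      rw [unitIntegral_apply, intervalIntegral.integral_eq_sub_of_hasDerivAt
        (f := fun x => (X ^ (a + 1) * (1 - X) ^ (b + 1) : ℝ[X]).eval x)
        (fun x _ => Polynomial.hasDerivAt _ x) ((Polynomial.continuous _).intervalIntegrable _ _)]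
      simp
    have hder : derivative (X ^ (a + 1) * (1 - X) ^ (b + 1) : ℝ[X]) =
        C (a + 1 : ℝ) * (X ^ a * (1 - X) ^ (b + 1))
          - C (b + 1 : ℝ) * (X ^ (a + 1) * (1 - X) ^ b) := by
      rw [derivative_mul, derivative_X_pow, derivative_pow]
      simp
      ring
    rw [hder, map_sub, unitIntegral_C_mul, unitIntegral_C_mul, ih (a + 1),
      show a + 1 + b + 1 = a + (b + 1) + 1 by ring] at hparts
    have hfac : ((a + (b + 1) + 1).factorial : ℝ) ≠ 0 := by positivity
    have ha : (a + 1 : ℝ) ≠ 0 := by positivity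
    rw [Nat.factorial_succ a] at hparts
    rw [Nat.factorial_succ b]
    push_cast at hparts ⊢
    field_simp at hparts ⊢
    rw [mul_zero, mul_eq_zero, or_iff_right ha] at hparts
    linarith

lemma unitIntegral_weight_pow (n : ℕ) :
    unitIntegral ((X * (1 - X)) ^ n) = (n.factorial : ℝ) ^ 2 / (2 * n + 1).factorial := by
  rw [mul_pow, unitIntegral_X_pow_mul, two_mul, sq]

/-- The Rodrigues form of the (unnormalised) shifted Legendre polynomial. -/
noncomputable def rodrigues (n : ℕ) : ℝ[X] := derivative^[n] ((X * (1 - X)) ^ n)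

lemma natDegree_rodrigues_le (n : ℕ) : (rodrigues n).natDegree ≤ n := by
  refine (natDegree_iterate_derivative _ _).trans ?_
  have := natDegree_weight_pow_le n
  omega

lemma coeff_rodrigues (n : ℕ) :
    (rodrigues n).coeff n = (-1) ^ n * ((2 * n).descFactorial n : ℝ) := by
  rw [rodrigues, coeff_iterate_derivative, ← two_mul, coeff_weight_pow, nsmul_eq_mul, mul_comm]

lemma iterate_derivative_eq_C_of_natDegree_le {n : ℕ} {s : ℝ[X]} (hs : s.natDegree ≤ n) :
    derivative^[n] s = C (n.factorial * s.coeff n) := by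
  ext k
  rw [coeff_iterate_derivative, coeff_C]
  split_ifs with h
  · simp [h, Nat.descFactorial_self]
  · rw [coeff_eq_zero_of_natDegree_lt (by omega), smul_zero]

lemma unitIntegral_rodrigues_mul {n : ℕ} {s : ℝ[X]} (hs : s.natDegree ≤ n) :
    unitIntegral (rodrigues n * s) =
      (-1) ^ n * (n.factorial * s.coeff n * unitIntegral ((X * (1 - X)) ^ n)) := by
  have h := unitIntegral_iterate_derivative_mul n 1 s
  rw [mul_one] at h
  rw [rodrigues, h, iterate_derivative_eq_C_of_natDegree_le hs, mul_comm _ (C _),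
    unitIntegral_C_mul]

lemma unitIntegral_rodrigues_mul_of_lt {n : ℕ} {s : ℝ[X]} (hs : s.natDegree < n) :
    unitIntegral (rodrigues n * s) = 0 := by
  rw [unitIntegral_rodrigues_mul hs.le, coeff_eq_zero_of_natDegree_lt hs]
  simp

lemma unitIntegral_rodrigues_sq (n : ℕ) :
    unitIntegral (rodrigues n * rodrigues n) =
      (n.factorial : ℝ) * (2 * n).descFactorial n * unitIntegral ((X * (1 - X)) ^ n) := by
  rw [unitIntegral_rodrigues_mul (natDegree_rodrigues_le n), coeff_rodrigues]
  have : ((-1 : ℝ) ^ n) * (-1) ^ n = 1 := by rw [← mul_pow]; simp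
  linear_combination
    ((n.factorial : ℝ) * (2 * n).descFactorial n * unitIntegral ((X * (1 - X)) ^ n)) * this

lemma natDegree_weighted_derivative_le {r m : ℕ} {s : ℝ[X]} (hs : s.natDegree ≤ m) :
    (derivative^[r] ((X * (1 - X)) ^ r * s)).natDegree ≤ m + r := by
  refine (natDegree_iterate_derivative _ _).trans ?_
  have := natDegree_mul_le_of_le (natDegree_weight_pow_le r) hs
  omega

lemma coeff_weighted_derivative {r m : ℕ} {s : ℝ[X]} (hs : s.natDegree ≤ m) :
    (derivative^[r] ((X * (1 - X)) ^ r * s)).coeff (m + r) =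
      (-1) ^ r * ((m + 2 * r).descFactorial r * s.coeff m) := by
  rw [coeff_iterate_derivative, show m + r + r = 2 * r + m by ring,
    coeff_mul_add_eq_of_natDegree_le (natDegree_weight_pow_le r) hs, coeff_weight_pow,
    nsmul_eq_mul, add_comm]
  ring

lemma unitIntegral_weight_mul_iterate_derivative_rodrigues {r m : ℕ} {s : ℝ[X]}
    (hs : s.natDegree ≤ m) :
    unitIntegral ((X * (1 - X)) ^ r * s * derivative^[r] (rodrigues (m + r))) =
      (-1) ^ (m + r) * ((m + r).factorial * ((m + 2 * r).descFactorial r * s.coeff m) *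
        unitIntegral ((X * (1 - X)) ^ (m + r))) := by
  have h := unitIntegral_iterate_derivative_mul r s (rodrigues (m + r))
  rw [mul_comm, unitIntegral_rodrigues_mul (natDegree_weighted_derivative_le hs),
    coeff_weighted_derivative hs] at h
  have hsq : ((-1 : ℝ) ^ r) * (-1) ^ r = 1 := by rw [← mul_pow]; simp
  refine mul_left_cancel₀ (pow_ne_zero r (by norm_num : (-1 : ℝ) ≠ 0)) ?_
  rw [← h]
  ring

lemma factorial_two_mul_le_descFactorial_mul (r m : ℕ) :
    (2 * r).factorial ≤ (m + 2 * r).descFactorial r * (m + r).descFactorial r := by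
  have h1 : (2 * r).descFactorial r * r.descFactorial r = (2 * r).factorial := by
    have := Nat.factorial_mul_descFactorial (n := 2 * r) (k := r) (by omega)
    rw [show 2 * r - r = r by omega] at this
    rw [Nat.descFactorial_self, mul_comm, this]
  rw [← h1]
  gcongr <;> omega

/-- A polynomial has an `r`-fold primitive whose norm is controlled by a weighted norm of the
polynomial itself. -/
lemma exists_iterate_derivative_eq (r N : ℕ) (q : ℝ[X]) (hq : q.degree < N) :
    ∃ Q : ℝ[X], derivative^[r] Q = q ∧ Q.degree < ((N + r : ℕ) : WithBot ℕ) ∧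
      (2 * r).factorial * unitIntegral (Q * Q) ≤
        unitIntegral ((X * (1 - X)) ^ r * q * q) := by
  induction N generalizing q with
  | zero =>
    have : q = 0 := by
      rw [← degree_eq_bot]
      simpa [Nat.WithBot.lt_zero_iff] using hq
    subst this
    exact ⟨0, by simp, by simp, by simp⟩
  | succ m ih =>
    set p := rodrigues (m + r) with hp
    set d := derivative^[r] p with hd
    have hpdeg : p.natDegree ≤ m + r := natDegree_rodrigues_le _
    have hddeg : d.natDegree ≤ m := by
      have : d.natDegree ≤ p.natDegree - r := natDegree_iterate_derivative p r
      omega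
    have hdcoeff : d.coeff m = (m + r).descFactorial r * p.coeff (m + r) := by
      rw [hd, coeff_iterate_derivative, nsmul_eq_mul]
    have hpcoeff : p.coeff (m + r) ≠ 0 := by
      rw [hp, coeff_rodrigues]
      have : (2 * (m + r)).descFactorial (m + r) ≠ 0 := by
        rw [Ne, Nat.descFactorial_eq_zero_iff_lt]
        omega
      simp [this]
    have hd0 : d.coeff m ≠ 0 := by
      rw [hdcoeff]
      have : (m + r).descFactorial r ≠ 0 := by
        rw [Ne, Nat.descFactorial_eq_zero_iff_lt]
        omega
      exact mul_ne_zero (by exact_mod_cast this) hpcoeff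
    set a := q.coeff m / d.coeff m with ha
    have hqdeg : q.natDegree ≤ m := natDegree_le_iff_coeff_eq_zero.2 fun k hk =>
      (degree_lt_iff_coeff_zero _ _).1 hq k (by omega)
    have hq'deg : (q - C a * d).degree < m := by
      rw [degree_lt_iff_coeff_zero]
      intro k hk
      rcases hk.eq_or_lt with rfl | hk
      · rw [coeff_sub, coeff_C_mul, ha, div_mul_cancel₀ _ hd0, sub_self]
      · rw [coeff_sub, coeff_C_mul, coeff_eq_zero_of_natDegree_lt (by omega : q.natDegree < k),
          coeff_eq_zero_of_natDegree_lt (by omega : d.natDegree < k), mul_zero, sub_zero]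
    obtain ⟨R, hR, hRdeg, hRle⟩ := ih _ hq'deg
    set s := q - C a * d with hs
    have hqs : q = C a * d + s := by rw [hs]; ring
    have hsm : s.natDegree ≤ m := natDegree_le_of_degree_le hq'deg.le
    have hsc : s.coeff m = 0 := coeff_eq_zero_of_degree_lt hq'deg
    refine ⟨C a * p + R, ?_, ?_, ?_⟩
    · rw [iterate_map_add, iterate_derivative_C_mul, hR, ← hd, ← hqs]
    · rw [degree_lt_iff_coeff_zero]
      intro k hk
      rw [coeff_add, coeff_C_mul, coeff_eq_zero_of_natDegree_lt (by omega : p.natDegree < k),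
        (degree_lt_iff_coeff_zero _ _).1 hRdeg k (by omega), mul_zero, add_zero]
    · have hpR : unitIntegral (p * R) = 0 := by
        rcases eq_or_ne R 0 with rfl | hR0
        · simp
        · exact unitIntegral_rodrigues_mul_of_lt ((natDegree_lt_iff_degree_lt hR0).2 hRdeg)
      have hsd : unitIntegral ((X * (1 - X)) ^ r * s * d) = 0 := by
        rw [hd, hp, unitIntegral_weight_mul_iterate_derivative_rodrigues hsm, hsc]
        simp
      have hdd : unitIntegral ((X * (1 - X)) ^ r * d * d) =
          ((m + 2 * r).descFactorial r * (m + r).descFactorial r : ℝ) * unitIntegral (p * p) := by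
        conv_lhs => rw [show (X * (1 - X)) ^ r * d * d =
          (X * (1 - X)) ^ r * d * derivative^[r] (rodrigues (m + r)) from rfl]
        rw [unitIntegral_weight_mul_iterate_derivative_rodrigues hddeg, hdcoeff, hp,
          unitIntegral_rodrigues_mul (natDegree_rodrigues_le _)]
        ring
      have hexp1 : unitIntegral ((C a * p + R) * (C a * p + R)) =
          a ^ 2 * unitIntegral (p * p) + unitIntegral (R * R) := by
        rw [show (C a * p + R) * (C a * p + R) =
            C a * (C a * (p * p)) + C a * (p * R) + C a * (p * R) + R * R by ring]
        simp only [map_add, unitIntegral_C_mul, hpR]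
        ring
      have hexp2 : unitIntegral ((X * (1 - X)) ^ r * q * q) =
          a ^ 2 * unitIntegral ((X * (1 - X)) ^ r * d * d) +
            unitIntegral ((X * (1 - X)) ^ r * s * s) := by
        rw [hqs, show (X * (1 - X)) ^ r * (C a * d + s) * (C a * d + s) =
            C a * (C a * ((X * (1 - X)) ^ r * d * d)) + C a * ((X * (1 - X)) ^ r * s * d)
              + C a * ((X * (1 - X)) ^ r * s * d) + (X * (1 - X)) ^ r * s * s by ring]
        simp only [map_add, unitIntegral_C_mul, hsd]
        ring
      have hpp : 0 ≤ unitIntegral (p * p) := by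
        have := unitIntegral_mono (p := 0) (q := p * p)
          (fun x _ => by simpa using mul_self_nonneg (p.eval x))
        simpa using this
      have hfac : ((2 * r).factorial : ℝ) ≤
          (m + 2 * r).descFactorial r * (m + r).descFactorial r := by
        exact_mod_cast factorial_two_mul_le_descFactorial_mul r m
      rw [hexp1, hexp2, hdd]
      have := mul_le_mul_of_nonneg_right hfac (mul_nonneg (sq_nonneg a) hpp)
      linarith

end Polynomial

lemma integral_sub_mul_sq {f g : ℝ → ℝ} (hf : ContinuousOn f (Icc 0 1))
    (hg : ContinuousOn g (Icc 0 1)) (a : ℝ) :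
    ∫ x in (0 : ℝ)..1, (f x - a * g x) ^ 2 =
      (∫ x in (0 : ℝ)..1, f x ^ 2) - 2 * a * (∫ x in (0 : ℝ)..1, f x * g x) +
        a ^ 2 * ∫ x in (0 : ℝ)..1, g x ^ 2 := by
  have hintegrable : ∀ h : ℝ → ℝ, ContinuousOn h (Icc 0 1) →
      IntervalIntegrable h MeasureTheory.volume 0 1 := fun h hh =>
    ContinuousOn.intervalIntegrable (by simpa using hh)
  rw [← intervalIntegral.integral_const_mul, ← intervalIntegral.integral_const_mul,
    ← intervalIntegral.integral_sub (hintegrable (fun x => f x ^ 2) (hf.pow 2))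
      (hintegrable (fun x => 2 * a * (f x * g x)) (continuousOn_const.mul (hf.mul hg))),
    ← intervalIntegral.integral_add
      (hintegrable (fun x => f x ^ 2 - 2 * a * (f x * g x))
        ((hf.pow 2).sub (continuousOn_const.mul (hf.mul hg))))
      (hintegrable (fun x => a ^ 2 * g x ^ 2) (continuousOn_const.mul (hg.pow 2)))]
  congr 1 with x
  ring

lemma Polynomial.four_pow_mul_unitIntegral_weight_le (r : ℕ) (q : Polynomial ℝ) :
    4 ^ r * unitIntegral ((X * (1 - X)) ^ r * q * q) ≤ unitIntegral (q * q) := by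
  have hC : (4 : ℝ) ^ r * unitIntegral ((X * (1 - X)) ^ r * q * q) =
      unitIntegral (C (4 ^ r) * ((X * (1 - X)) ^ r * q * q)) := (unitIntegral_C_mul _ _).symm
  rw [hC]
  refine unitIntegral_mono fun x hx => ?_
  have h1 : (4 * (x * (1 - x))) ^ r ≤ 1 := by
    refine pow_le_one₀ ?_ ?_
    · have := mul_nonneg hx.1 (sub_nonneg.2 hx.2)
      positivity
    · nlinarith [sq_nonneg (2 * x - 1)]
  simp only [eval_mul, eval_C, eval_pow, eval_X, eval_sub, eval_one]
  have := mul_le_mul_of_nonneg_right h1 (mul_self_nonneg (q.eval x))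
  rw [mul_pow] at this
  linarith

/-- The Wirtinger inequality with constant `4 ^ r * (2 * r)!` for a function given together with
its successive derivatives. -/
lemma four_pow_mul_factorial_mul_integral_sq_le (r : ℕ) (F : ℕ → ℝ → ℝ)
    (hF : ∀ k ≤ r, ContinuousOn (F k) (Icc 0 1))
    (hF' : ∀ k < r, ∀ x ∈ Ioo (0 : ℝ) 1, HasDerivAt (F k) (F (k + 1) x) x)
    (h0 : ∀ k < r, F k 0 = 0 ∧ F k 1 = 0) :
    4 ^ r * (2 * r).factorial * ∫ x in (0 : ℝ)..1, F 0 x ^ 2 ≤ ∫ x in (0 : ℝ)..1, F r x ^ 2 := by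
  set c : ℝ := 4 ^ r * (2 * r).factorial with hc
  have hc0 : 0 < c := by positivity
  refine le_of_forall_pos_le_add fun ε hε => ?_
  set δ := min 1 (ε / c) with hδ
  have hδ0 : 0 < δ := by positivity
  have hδε : c * δ ^ 2 ≤ ε := by
    have h1 : δ ^ 2 ≤ δ := by nlinarith [min_le_left 1 (ε / c)]
    have h2 : c * δ ≤ ε := by
      have := min_le_right 1 (ε / c)
      rwa [le_div_iff₀' hc0] at this
    nlinarith
  obtain ⟨q, hq⟩ := exists_polynomial_near_of_continuousOn 0 1 (F 0) (hF 0 (Nat.zero_le r)) δ hδ0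
  obtain ⟨Q, hQ, -, hQle⟩ := Polynomial.exists_iterate_derivative_eq r (q.natDegree + 1) q
    (Polynomial.degree_le_natDegree.trans_lt (by exact_mod_cast Nat.lt_succ_self _))
  have hparts := integral_mul_eval_iterate_derivative r F Q hF hF' h0
  rw [hQ] at hparts
  have hsign : ((-1 : ℝ) ^ r) * (-1) ^ r = 1 := by rw [← mul_pow]; simp
  have hsq1 := integral_sub_mul_sq (hF r le_rfl) Q.continuous.continuousOn ((-1) ^ r * c)
  have hnonneg : 0 ≤ ∫ x in (0 : ℝ)..1, (F r x - (-1) ^ r * c * Q.eval x) ^ 2 :=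
    intervalIntegral.integral_nonneg zero_le_one fun x _ => sq_nonneg _
  have hsq2 := integral_sub_mul_sq (hF 0 (Nat.zero_le r)) q.continuous.continuousOn 1
  have hsmall : ∫ x in (0 : ℝ)..1, (F 0 x - 1 * q.eval x) ^ 2 ≤ δ ^ 2 := by
    have : ∫ x in (0 : ℝ)..1, (F 0 x - 1 * q.eval x) ^ 2 ≤ ∫ x in (0 : ℝ)..1, δ ^ 2 := by
      refine intervalIntegral.integral_mono_on zero_le_one ?_ (by simp) fun x hx => ?_
      · refine ContinuousOn.intervalIntegrable ?_
        rw [uIcc_of_le zero_le_one]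
        exact ((hF 0 (Nat.zero_le r)).sub (by fun_prop)).pow 2
      · rw [one_mul, ← sq_abs, abs_sub_comm]
        exact pow_le_pow_left₀ (abs_nonneg _) (hq x hx).le 2
    simpa using this
  have hweight := Polynomial.four_pow_mul_unitIntegral_weight_le r q
  have hQq : c * ∫ x in (0 : ℝ)..1, Q.eval x ^ 2 ≤ ∫ x in (0 : ℝ)..1, q.eval x ^ 2 := by
    have h := (mul_le_mul_of_nonneg_left hQle (by positivity : (0 : ℝ) ≤ 4 ^ r)).trans hweight
    rw [← mul_assoc, ← hc] at h
    simpa [Polynomial.unitIntegral_apply, sq] using h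
  rw [hparts] at hsq1
  have hsq1' : ∫ x in (0 : ℝ)..1, (F r x - (-1) ^ r * c * Q.eval x) ^ 2 =
      (∫ x in (0 : ℝ)..1, F r x ^ 2) - 2 * c * (∫ x in (0 : ℝ)..1, F 0 x * q.eval x) +
        c * (c * ∫ x in (0 : ℝ)..1, Q.eval x ^ 2) := by
    rw [hsq1]
    linear_combination (-2 * c * (∫ x in (0 : ℝ)..1, F 0 x * q.eval x) +
      c ^ 2 * ∫ x in (0 : ℝ)..1, Q.eval x ^ 2) * hsign
  rw [hsq1'] at hnonneg
  rw [hsq2] at hsmall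
  have h1 := mul_le_mul_of_nonneg_left hQq hc0.le
  have h2 := mul_le_mul_of_nonneg_left hsmall hc0.le
  linarith

lemma four_pow_mul_factorial_mul_integral_norm_sq_le (r : ℕ) (f : ℝ → ℂ)
    (hf : ContDiffOn ℝ r f (Icc 0 1))
    (h0 : ∀ l < r, iteratedDerivWithin l f (Icc 0 1) 0 = 0 ∧
      iteratedDerivWithin l f (Icc 0 1) 1 = 0) :
    4 ^ r * (2 * r).factorial * (∫ x in (0 : ℝ)..1, ‖f x‖ ^ 2) ≤
      ∫ x in (0 : ℝ)..1, ‖iteratedDerivWithin r f (Icc 0 1) x‖ ^ 2 := by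
  have hu : UniqueDiffOn ℝ (Icc (0 : ℝ) 1) := uniqueDiffOn_Icc zero_lt_one
  have hcont : ∀ k ≤ r, ContinuousOn (iteratedDerivWithin k f (Icc 0 1)) (Icc 0 1) :=
    fun k hk => hf.continuousOn_iteratedDerivWithin (by exact_mod_cast hk) hu
  have hder : ∀ k < r, ∀ x ∈ Ioo (0 : ℝ) 1, HasDerivAt (iteratedDerivWithin k f (Icc 0 1))
      (iteratedDerivWithin (k + 1) f (Icc 0 1) x) x := fun k hk x hx => by
    have h := hf.differentiableOn_iteratedDerivWithin (by exact_mod_cast hk) hu x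
      (Ioo_subset_Icc_self hx)
    rw [iteratedDerivWithin_succ]
    exact h.hasDerivWithinAt.hasDerivAt (Icc_mem_nhds hx.1 hx.2)
  have hre := four_pow_mul_factorial_mul_integral_sq_le r
    (fun k x => (iteratedDerivWithin k f (Icc 0 1) x).re)
    (fun k hk => Complex.continuous_re.comp_continuousOn (hcont k hk))
    (fun k hk x hx => Complex.reCLM.hasFDerivAt.comp_hasDerivAt x (hder k hk x hx))
    (fun k hk => by simp [h0 k hk])
  have him := four_pow_mul_factorial_mul_integral_sq_le r
    (fun k x => (iteratedDerivWithin k f (Icc 0 1) x).im)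
    (fun k hk => Complex.continuous_im.comp_continuousOn (hcont k hk))
    (fun k hk x hx => Complex.imCLM.hasFDerivAt.comp_hasDerivAt x (hder k hk x hx))
    (fun k hk => by simp [h0 k hk])
  have hsplit : ∀ g : ℝ → ℂ, ContinuousOn g (Icc 0 1) → ∫ x in (0 : ℝ)..1, ‖g x‖ ^ 2 =
      (∫ x in (0 : ℝ)..1, (g x).re ^ 2) + ∫ x in (0 : ℝ)..1, (g x).im ^ 2 := fun g hg => by
    rw [← intervalIntegral.integral_add]
    · congr 1 with x
      rw [Complex.sq_norm, Complex.normSq_apply]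
      ring
    · refine ContinuousOn.intervalIntegrable ?_
      rw [uIcc_of_le zero_le_one]
      exact (Complex.continuous_re.comp_continuousOn hg).pow 2
    · refine ContinuousOn.intervalIntegrable ?_
      rw [uIcc_of_le zero_le_one]
      exact (Complex.continuous_im.comp_continuousOn hg).pow 2
  simp only [iteratedDerivWithin_zero] at hre him
  rw [hsplit f hf.continuousOn, hsplit _ (hcont r le_rfl)]
  linarith

lemma iteratedDerivWithin_ofReal_eval (p : Polynomial ℝ) (k : ℕ) {x : ℝ} (hx : x ∈ Icc (0 : ℝ) 1) :
    iteratedDerivWithin k (fun y : ℝ => ((p.eval y : ℝ) : ℂ)) (Icc 0 1) x =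
      (((Polynomial.derivative^[k] p).eval x : ℝ) : ℂ) := by
  induction k generalizing x with
  | zero => simp
  | succ k ih =>
    rw [iteratedDerivWithin_succ, derivWithin_congr (fun y hy => ih hy) (ih hx),
      Function.iterate_succ_apply']
    exact (Polynomial.hasDerivAt _ x).ofReal_comp.hasDerivWithinAt.derivWithin
      (uniqueDiffOn_Icc zero_lt_one x hx)

open Polynomial in
/-- The Rayleigh quotient of `(x (1 - x)) ^ r` bounds every admissible Wirtinger constant. -/
lemma le_of_wirtinger_inequality {r : ℕ} {c : ℝ}
    (hc : ∀ f : ℝ → ℂ, ContDiffOn ℝ r f (Icc 0 1) →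
      (∀ l < r, iteratedDerivWithin l f (Icc 0 1) 0 = 0 ∧
        iteratedDerivWithin l f (Icc 0 1) 1 = 0) →
      c * (∫ x in (0 : ℝ)..1, ‖f x‖ ^ 2)
        ≤ ∫ x in (0 : ℝ)..1, ‖iteratedDerivWithin r f (Icc 0 1) x‖ ^ 2) :
    c ≤ ((4 * r + 1 : ℝ) / (2 * r + 1)) *
        ((Nat.factorial (4 * r) : ℝ) * (Nat.factorial r : ℝ) ^ 2 /
          (Nat.factorial (2 * r) : ℝ) ^ 2) := by
  set p : ℝ[X] := (X * (1 - X)) ^ r with hp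
  have hzero : ∀ l < r, (derivative^[l] p).eval 0 = 0 ∧ (derivative^[l] p).eval 1 = 0 :=
    fun l hl => by simpa using iterate_derivative_weight_eval_eq_zero hl 1
  have h := hc (fun y : ℝ => ((p.eval y : ℝ) : ℂ))
    ((Complex.ofRealCLM.contDiff.comp (by simpa using p.contDiff_aeval (𝕜 := ℝ) r)).contDiffOn)
    (fun l hl => by
      rw [iteratedDerivWithin_ofReal_eval p l (by simp),
        iteratedDerivWithin_ofReal_eval p l (by simp)]
      simp [hzero l hl])
  have hleft : ∫ x in (0 : ℝ)..1, ‖((p.eval x : ℝ) : ℂ)‖ ^ 2 =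
      ((2 * r).factorial : ℝ) ^ 2 / (2 * (2 * r) + 1).factorial := by
    rw [← unitIntegral_weight_pow, unitIntegral_apply]
    congr 1 with x
    rw [Complex.norm_real, Real.norm_eq_abs, sq_abs, hp]
    simp only [eval_pow]
    ring
  have hright : ∫ x in (0 : ℝ)..1,
      ‖iteratedDerivWithin r (fun y : ℝ => ((p.eval y : ℝ) : ℂ)) (Icc 0 1) x‖ ^ 2 =
        (r.factorial : ℝ) * (2 * r).descFactorial r *
          ((r.factorial : ℝ) ^ 2 / (2 * r + 1).factorial) := by
    rw [← unitIntegral_weight_pow, ← unitIntegral_rodrigues_sq, unitIntegral_apply]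
    refine intervalIntegral.integral_congr fun x hx => ?_
    rw [uIcc_of_le zero_le_one] at hx
    simp only [iteratedDerivWithin_ofReal_eval p r hx, Complex.norm_real, Real.norm_eq_abs,
      sq_abs, eval_mul, rodrigues, ← hp]
    ring
  rw [hleft, hright] at h
  have hdesc : (r.factorial : ℝ) * (2 * r).descFactorial r = (2 * r).factorial := by
    have := Nat.factorial_mul_descFactorial (n := 2 * r) (k := r) (by omega)
    rw [show 2 * r - r = r by omega] at this
    exact_mod_cast this
  rw [hdesc, Nat.factorial_succ (2 * r), Nat.factorial_succ (2 * (2 * r)),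
    show 2 * (2 * r) = 4 * r by ring] at h
  push_cast at h
  have h2 : (0 : ℝ) < (2 * r).factorial := by positivity
  have h4 : (0 : ℝ) < (4 * r).factorial := by positivity
  rw [← le_div_iff₀ (by positivity)] at h
  refine h.trans_eq ?_
  field_simp

lemma factorial_four_mul_mul_sq_le (r : ℕ) :
    (4 * r).factorial * r.factorial ^ 2 ≤ 4 ^ r * (2 * r).factorial ^ 3 := by
  induction r with
  | zero => simp
  | succ r ih =>
    have h4 : (4 * (r + 1)).factorial =
        (4 * r + 4) * (4 * r + 3) * (4 * r + 2) * (4 * r + 1) * (4 * r).factorial := by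
      rw [show 4 * (r + 1) = 4 * r + 1 + 1 + 1 + 1 by ring]
      simp only [Nat.factorial_succ]
      ring
    have h2 : (2 * (r + 1)).factorial = (2 * r + 2) * (2 * r + 1) * (2 * r).factorial := by
      rw [show 2 * (r + 1) = 2 * r + 1 + 1 by ring]
      simp only [Nat.factorial_succ]
      ring
    rw [h4, h2, Nat.factorial_succ r]
    have hstep : (4 * r + 4) * (4 * r + 3) * (4 * r + 2) * (4 * r + 1) * (r + 1) ^ 2 ≤
        4 * ((2 * r + 2) * (2 * r + 1)) ^ 3 := by
      have : (4 * r + 3) * (4 * r + 1) ≤ 4 * (2 * r + 1) ^ 2 := by nlinarith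
      calc _ = 8 * (r + 1) ^ 3 * (2 * r + 1) * ((4 * r + 3) * (4 * r + 1)) := by ring
        _ ≤ 8 * (r + 1) ^ 3 * (2 * r + 1) * (4 * (2 * r + 1) ^ 2) := by gcongr
        _ = _ := by ring
    calc _ = ((4 * r + 4) * (4 * r + 3) * (4 * r + 2) * (4 * r + 1) * (r + 1) ^ 2) *
          ((4 * r).factorial * r.factorial ^ 2) := by ring
      _ ≤ (4 * ((2 * r + 2) * (2 * r + 1)) ^ 3) * (4 ^ r * (2 * r).factorial ^ 3) := by gcongr
      _ = _ := by ring

lemma lower_bound_le_four_pow_mul_factorial {r : ℕ} (hr : 1 ≤ r) :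
    ((4 * r - 2 : ℝ) / (4 * r ^ 2 - r)) *
        ((Nat.factorial (4 * r) : ℝ) * (Nat.factorial r : ℝ) ^ 2 /
          (Nat.factorial (2 * r) : ℝ) ^ 2) ≤ 4 ^ r * (2 * r).factorial := by
  have hr' : (1 : ℝ) ≤ r := by exact_mod_cast hr
  have h1 : (4 * r - 2 : ℝ) / (4 * r ^ 2 - r) ≤ 1 := by
    rw [div_le_one (by nlinarith)]
    nlinarith [sq_nonneg (8 * (r : ℝ) - 5)]
  have h2 : (Nat.factorial (4 * r) : ℝ) * (Nat.factorial r : ℝ) ^ 2 /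
      (Nat.factorial (2 * r) : ℝ) ^ 2 ≤ 4 ^ r * (2 * r).factorial := by
    rw [div_le_iff₀ (by positivity)]
    have : ((4 * r).factorial : ℝ) * (r.factorial : ℝ) ^ 2 ≤
        4 ^ r * ((2 * r).factorial : ℝ) ^ 3 := by
      exact_mod_cast factorial_four_mul_mul_sq_le r
    linarith
  exact (mul_le_of_le_one_left (by positivity) h1).trans h2

/-- Bounds for the Wirtinger–Sobolev constant:
`(4r−2)/(4r²−r) · (4r)!(r!)²/((2r)!)² ≤ c_r ≤ (4r+1)/(2r+1) · (4r)!(r!)²/((2r)!)²`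
for every `r ≥ 1`. -/
theorem stmt_14 (r : ℕ) (hr : 1 ≤ r) :
    ((4 * r - 2 : ℝ) / (4 * r ^ 2 - r)) *
        ((Nat.factorial (4 * r) : ℝ) * (Nat.factorial r : ℝ) ^ 2 /
          (Nat.factorial (2 * r) : ℝ) ^ 2)
      ≤ wirtingerConst r ∧
    wirtingerConst r
      ≤ ((4 * r + 1 : ℝ) / (2 * r + 1)) *
        ((Nat.factorial (4 * r) : ℝ) * (Nat.factorial r : ℝ) ^ 2 /
          (Nat.factorial (2 * r) : ℝ) ^ 2) := by
  have hmem : (4 ^ r * (2 * r).factorial : ℝ) ∈ {c : ℝ | ∀ f : ℝ → ℂ,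
      ContDiffOn ℝ r f (Icc 0 1) →
      (∀ l < r, iteratedDerivWithin l f (Icc 0 1) 0 = 0 ∧
        iteratedDerivWithin l f (Icc 0 1) 1 = 0) →
      c * (∫ x in (0 : ℝ)..1, ‖f x‖ ^ 2)
        ≤ ∫ x in (0 : ℝ)..1, ‖iteratedDerivWithin r f (Icc 0 1) x‖ ^ 2} :=
    four_pow_mul_factorial_mul_integral_norm_sq_le r
  refine ⟨(lower_bound_le_four_pow_mul_factorial hr).trans (le_csSup ?_ hmem),
    csSup_le ⟨_, hmem⟩ fun c hc => le_of_wirtinger_inequality hc⟩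
  exact ⟨_, fun c hc => le_of_wirtinger_inequality hc⟩
end
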